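/- Let 0 < δ < π and define f : [−π, π] → ℂ by: f(θ) = 1/2 + (i·tan(δ/2)/(2(π−δ)))·(θ+π) for −π ≤ θ ≤ −δ; f(θ) = 1/2 − (i/2)·tan(θ/2) for −δ ≤ θ ≤ δ; and f(θ) = 1/2 + (i/2)·tan(δ/2)·(−1 + (θ−δ)/(π−δ)) for δ ≤ θ ≤ π. Then: (i) f is absolutely continuous with f(−π) = f(π) and ∫_{−π}^{π} |f′(θ)|² dθ = tan²(δ/2)/(2(π−δ)) + tan³(δ/2)/12 + tan(δ/2)/4; (ii) setting b_n = (1/2π)∫_{−π}^{π} f(θ)e^{−inθ} dθ and a_n = (−1)ⁿ b_n for n ∈ ℤ, one has Σ_{n∈ℤ} |a_n| < ∞, Σ_{n∈ℤ} (−1)ⁿ a_n e^{inθ} = 1/(1 + e^{iθ}) for every θ ∈ (−δ, δ), and 2·Σ_{n∈ℤ} |a_n| ≤ 1 + (π/√3)·√( 2·tan²(δ/2)/(π−δ) + tan³(δ/2)/3 + tan(δ/2) ). -/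

import Mathlib

open Real MeasureTheory

-- the piecewise function f on [−π, π]
noncomputable def fdel (δ θ : ℝ) : ℂ :=
  if θ ≤ -δ then
    1 / 2 + Complex.I * (Real.tan (δ / 2) : ℂ) / (2 * ((π : ℂ) - (δ : ℂ))) * ((θ : ℂ) + (π : ℂ))
  else if θ ≤ δ then
    1 / 2 - Complex.I / 2 * (Real.tan (θ / 2) : ℂ)
  else
    1 / 2 + Complex.I / 2 * (Real.tan (δ / 2) : ℂ) *
      (-1 + ((θ : ℂ) - (δ : ℂ)) / ((π : ℂ) - (δ : ℂ)))

-- Fourier coefficients b_n of f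
noncomputable def bcoef (δ : ℝ) (m : ℤ) : ℂ :=
  (1 / (2 * (π : ℂ))) * ∫ θ in (-π)..π, fdel δ θ * Complex.exp (-(Complex.I * (m : ℂ) * (θ : ℂ)))

-- a_n = (−1)ⁿ b_n
noncomputable def acoef (δ : ℝ) (m : ℤ) : ℂ := (-1 : ℂ) ^ m * bcoef δ m

noncomputable def hh (δ θ : ℝ) : ℝ :=
  if θ ≤ -δ then Real.tan (δ / 2) / (π - δ) * (θ + π)
  else if θ ≤ δ then - Real.tan (θ / 2)
  else Real.tan (δ / 2) * (-1 + (θ - δ) / (π - δ))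

noncomputable def kk (δ θ : ℝ) : ℝ :=
  if θ < -δ then Real.tan (δ / 2) / (π - δ)
  else if θ < δ then - (1 / 2 / Real.cos (θ / 2) ^ 2)
  else Real.tan (δ / 2) / (π - δ)

lemma fdel_eq (δ θ : ℝ) (hδπ : δ < π) : fdel δ θ = 1 / 2 + Complex.I / 2 * (hh δ θ : ℂ) := by
  have h : (π : ℂ) - δ ≠ 0 := by
    rw [← Complex.ofReal_sub]; exact_mod_cast (sub_pos.2 hδπ).ne'
  unfold fdel hh
  split_ifs
  · push_cast; field_simp
  · push_cast; ring
  · push_cast; ring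

lemma cos_half_pos {x : ℝ} (h1 : -π < x) (h2 : x < π) : 0 < Real.cos (x / 2) :=
  Real.cos_pos_of_mem_Ioo ⟨by linarith, by linarith⟩

lemma hd_tan {x : ℝ} (h1 : -π < x) (h2 : x < π) :
    HasDerivAt (fun y : ℝ => Real.tan (y / 2)) (1 / 2 / Real.cos (x / 2) ^ 2) x := by
  have h := (Real.hasDerivAt_tan (cos_half_pos h1 h2).ne').comp x ((hasDerivAt_id x).div_const 2)
  refine h.congr_deriv ?_
  simp; ring

lemma hh1 {δ θ : ℝ} (h : θ ≤ -δ) : hh δ θ = Real.tan (δ / 2) / (π - δ) * (θ + π) := by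
  simp [hh, h]

lemma hh2 {δ θ : ℝ} (hδ : 0 < δ) (hδπ : δ < π) (h : -δ ≤ θ) (h' : θ ≤ δ) :
    hh δ θ = - Real.tan (θ / 2) := by
  have h0 : π - δ ≠ 0 := (sub_pos.2 hδπ).ne'
  rcases h.eq_or_lt with rfl | h
  · rw [hh1 le_rfl, neg_div, Real.tan_neg]; field_simp; ring
  · simp [hh, h.not_ge, h']

lemma hh3 {δ θ : ℝ} (hδ : 0 < δ) (hδπ : δ < π) (h : δ ≤ θ) :
    hh δ θ = Real.tan (δ / 2) * (-1 + (θ - δ) / (π - δ)) := by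
  rcases h.eq_or_lt with rfl | h
  · rw [hh2 hδ hδπ (by linarith) le_rfl]; simp
  · have : ¬ θ ≤ -δ := by linarith
    simp [hh, h.not_ge, this]

lemma hh_cont {δ : ℝ} (hδ : 0 < δ) (hδπ : δ < π) : Continuous (hh δ) := by
  rw [← continuousOn_univ]
  have : (Set.univ : Set ℝ) = Set.Iic (-δ) ∪ Set.Icc (-δ) δ ∪ Set.Ici δ := by
    ext x; simp only [Set.mem_univ, Set.mem_union, Set.mem_Iic, Set.mem_Icc, Set.mem_Ici, true_iff]
    rcases le_total x (-δ) with h | h <;> rcases le_total x δ with h' | h' <;> tauto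
  rw [this]
  refine ContinuousOn.union_of_isClosed (ContinuousOn.union_of_isClosed ?_ ?_ isClosed_Iic isClosed_Icc) ?_
    (isClosed_Iic.union isClosed_Icc) isClosed_Ici
  · refine ContinuousOn.congr (f := fun θ => Real.tan (δ / 2) / (π - δ) * (θ + π)) ?_ (fun x hx => hh1 hx)
    fun_prop
  · refine ContinuousOn.congr (f := fun θ => - Real.tan (θ / 2)) ?_ (fun x hx => hh2 hδ hδπ hx.1 hx.2)
    intro x hx
    exact (hd_tan (by linarith [hx.1]) (by linarith [hx.2])).continuousAt.neg.continuousWithinAt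
  · refine ContinuousOn.congr (f := fun θ => Real.tan (δ / 2) * (-1 + (θ - δ) / (π - δ))) ?_
      (fun x hx => hh3 hδ hδπ hx)
    fun_prop

lemma hh_deriv {δ : ℝ} (hδ : 0 < δ) (hδπ : δ < π) (x : ℝ) :
    HasDerivWithinAt (hh δ) (kk δ x) (Set.Ioi x) x := by
  rcases lt_or_ge x (-δ) with h1 | h1
  · have : kk δ x = Real.tan (δ / 2) / (π - δ) := by simp [kk, h1]
    rw [this]
    have hd : HasDerivAt (fun θ => Real.tan (δ / 2) / (π - δ) * (θ + π)) (Real.tan (δ / 2) / (π - δ)) x := by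
      simpa using ((hasDerivAt_id x).add_const π).const_mul (Real.tan (δ / 2) / (π - δ))
    refine (hd.congr_of_eventuallyEq ?_).hasDerivWithinAt
    filter_upwards [Iio_mem_nhds h1] with y hy using hh1 (le_of_lt hy)
  rcases lt_or_ge x δ with h2 | h2
  · have : kk δ x = - (1 / 2 / Real.cos (x / 2) ^ 2) := by simp [kk, h1.not_gt, h2]
    rw [this]
    have hd := (hd_tan (show -π < x by linarith) (show x < π by linarith)).neg
    refine hd.hasDerivWithinAt.congr_of_eventuallyEq ?_ (hh2 hδ hδπ h1 h2.le)
    filter_upwards [self_mem_nhdsWithin, mem_nhdsWithin_of_mem_nhds (Iio_mem_nhds h2)] with y hy hy'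
    exact hh2 hδ hδπ (h1.trans (le_of_lt hy)) (le_of_lt hy')
  · have : kk δ x = Real.tan (δ / 2) / (π - δ) := by simp [kk, h1.not_gt, h2.not_gt]
    rw [this]
    have hd : HasDerivAt (fun θ => Real.tan (δ / 2) * (-1 + (θ - δ) / (π - δ)))
        (Real.tan (δ / 2) / (π - δ)) x := by
      have := ((((hasDerivAt_id x).sub_const δ).div_const (π - δ)).const_add (-1)).const_mul
        (Real.tan (δ / 2))
      refine this.congr_deriv ?_; ring
    refine hd.hasDerivWithinAt.congr ?_ (hh3 hδ hδπ h2)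
    intro y hy
    exact hh3 hδ hδπ (h2.trans (le_of_lt hy))

lemma hh_odd {δ : ℝ} (hδ : 0 < δ) (hδπ : δ < π) (x : ℝ) : hh δ (-x) = - hh δ x := by
  have h0 : π - δ ≠ 0 := (sub_pos.2 hδπ).ne'
  rcases le_total x (-δ) with h1 | h1
  · rw [hh1 h1, hh3 hδ hδπ (by linarith)]; field_simp; ring
  rcases le_total x δ with h2 | h2
  · rw [hh2 hδ hδπ h1 h2, hh2 hδ hδπ (by linarith) (by linarith), neg_div, Real.tan_neg]
  · rw [hh3 hδ hδπ h2, hh1 (by linarith)]; field_simp; ring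

lemma hh_int {δ : ℝ} (hδ : 0 < δ) (hδπ : δ < π) : ∫ x in (-π)..π, hh δ x = 0 := by
  have h := intervalIntegral.integral_comp_neg (a := -π) (b := π) (hh δ)
  simp only [hh_odd hδ hδπ, neg_neg, intervalIntegral.integral_neg] at h
  linarith

lemma kk_meas (δ : ℝ) : Measurable (kk δ) := by
  unfold kk
  refine Measurable.ite measurableSet_Iio measurable_const
    (Measurable.ite measurableSet_Iio ?_ measurable_const)
  have : Measurable (fun x : ℝ => Real.cos (x / 2)) := (by fun_prop : Continuous _).measurable
  exact ((this.pow_const 2).const_div _).neg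

lemma kk_bdd {δ : ℝ} (hδ : 0 < δ) (hδπ : δ < π) : ∃ C, ∀ x, |kk δ x| ≤ C := by
  have hc := cos_half_pos (show -π < δ by linarith) hδπ
  refine ⟨max |Real.tan (δ / 2) / (π - δ)| (1 / 2 / Real.cos (δ / 2) ^ 2), fun x => ?_⟩
  unfold kk
  split_ifs with h1 h2
  · exact le_max_left _ _
  · refine le_max_of_le_right ?_
    rw [abs_neg, abs_of_nonneg (by positivity)]
    have : Real.cos (δ / 2) ≤ Real.cos (x / 2) := by
      rw [← Real.cos_abs (x / 2)]
      apply Real.cos_le_cos_of_nonneg_of_le_pi (abs_nonneg _) (by linarith)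
      rw [abs_le]; constructor <;> linarith
    gcongr
  · exact le_max_left _ _

noncomputable def gg (δ θ : ℝ) : ℂ := Complex.I / 2 * (kk δ θ : ℂ)

lemma gg_norm (δ θ : ℝ) : ‖gg δ θ‖ = |kk δ θ| / 2 := by
  simp [gg]; ring

lemma gg_memLp {δ : ℝ} (hδ : 0 < δ) (hδπ : δ < π) (s : Set ℝ) [IsFiniteMeasure (volume.restrict s)]
    (p : ENNReal) :
    MemLp (gg δ) p (volume.restrict s) := by
  obtain ⟨C, hC⟩ := kk_bdd hδ hδπ
  refine MemLp.of_bound ?_ (C / 2) (Filter.Eventually.of_forall fun x => ?_)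
  · exact ((Complex.measurable_ofReal.comp (kk_meas δ)).const_mul _).aestronglyMeasurable
  · rw [gg_norm]; linarith [hC x]

lemma gg_ii {δ : ℝ} (hδ : 0 < δ) (hδπ : δ < π) (a b : ℝ) : IntervalIntegrable (gg δ) volume a b :=
  ⟨memLp_one_iff_integrable.1 (gg_memLp hδ hδπ _ 1), memLp_one_iff_integrable.1 (gg_memLp hδ hδπ _ 1)⟩

lemma fdel_cont {δ : ℝ} (hδ : 0 < δ) (hδπ : δ < π) : Continuous (fdel δ) := by
  have : fdel δ = fun θ => 1 / 2 + Complex.I / 2 * (hh δ θ : ℂ) := funext fun θ => fdel_eq δ θ hδπ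
  rw [this]
  have := hh_cont hδ hδπ
  fun_prop

lemma fdel_deriv {δ : ℝ} (hδ : 0 < δ) (hδπ : δ < π) (x : ℝ) :
    HasDerivWithinAt (fdel δ) (gg δ x) (Set.Ioi x) x := by
  have : fdel δ = fun θ => 1 / 2 + Complex.I / 2 * (hh δ θ : ℂ) := funext fun θ => fdel_eq δ θ hδπ
  rw [this]
  exact ((hh_deriv hδ hδπ x).ofReal_comp.const_mul _).const_add _

lemma fdel_per {δ : ℝ} (hδ : 0 < δ) (hδπ : δ < π) : fdel δ (-π) = fdel δ π := by
  have h0 : π - δ ≠ 0 := (sub_pos.2 hδπ).ne'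
  rw [fdel_eq _ _ hδπ, fdel_eq _ _ hδπ, hh1 (by linarith), hh3 hδ hδπ hδπ.le]
  simp [div_self h0]

lemma gg_int {δ : ℝ} (hδ : 0 < δ) (hδπ : δ < π) :
    (∫ θ in (-π)..π, ‖gg δ θ‖ ^ 2)
        = Real.tan (δ / 2) ^ 2 / (2 * (π - δ)) + Real.tan (δ / 2) ^ 3 / 12
          + Real.tan (δ / 2) / 4 := by
  have h0 : π - δ ≠ 0 := (sub_pos.2 hδπ).ne'
  have hii : ∀ a b, IntervalIntegrable (fun θ => ‖gg δ θ‖ ^ 2) volume a b := fun a b =>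
    ⟨(gg_memLp hδ hδπ _ 2).integrable_norm_pow (by norm_num),
      (gg_memLp hδ hδπ _ 2).integrable_norm_pow (by norm_num)⟩
  rw [← intervalIntegral.integral_add_adjacent_intervals (hii (-π) δ) (hii δ π),
    ← intervalIntegral.integral_add_adjacent_intervals (hii (-π) (-δ)) (hii (-δ) δ)]
  have e1 : (∫ θ in (-π)..(-δ), ‖gg δ θ‖ ^ 2) = ∫ θ in (-π)..(-δ), (Real.tan (δ / 2) / (π - δ) / 2) ^ 2 := by
    refine intervalIntegral.integral_congr_Ioo_of_le (by linarith) fun x hx => ?_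
    have : x < -δ := hx.2
    simp only [gg_norm, div_pow, sq_abs]
    simp [kk, this, div_pow]
  have e3 : (∫ θ in δ..π, ‖gg δ θ‖ ^ 2) = ∫ θ in δ..π, (Real.tan (δ / 2) / (π - δ) / 2) ^ 2 := by
    refine intervalIntegral.integral_congr_Ioo_of_le (by linarith) fun x hx => ?_
    have h1 : ¬ x < δ := hx.1.not_gt
    have h2 : ¬ x < -δ := by linarith [hx.1]
    simp only [gg_norm, div_pow, sq_abs]
    simp [kk, h1, h2, div_pow]
  have e2 : (∫ θ in (-δ)..δ, ‖gg δ θ‖ ^ 2) = Real.tan (δ / 2) ^ 3 / 12 + Real.tan (δ / 2) / 4 := by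
    rw [intervalIntegral.integral_eq_sub_of_hasDeriv_right_of_le (by linarith)
      (f := fun x => (Real.tan (x / 2) + Real.tan (x / 2) ^ 3 / 3) / 8) _ _ (hii _ _)]
    · rw [neg_div, Real.tan_neg]; ring
    · intro x hx
      have := (hd_tan (show -π < x by linarith [hx.1]) (show x < π by linarith [hx.2])).continuousAt
      exact ((this.add ((this.pow 3).div_const 3)).div_const 8).continuousWithinAt
    · intro x hx
      have hp := cos_half_pos (show -π < x by linarith [hx.1]) (show x < π by linarith [hx.2])
      have hd := hd_tan (show -π < x by linarith [hx.1]) (show x < π by linarith [hx.2])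
      have hd2 := ((hd.add ((hd.pow 3).div_const 3)).div_const 8).hasDerivWithinAt (s := Set.Ioi x)
      refine hd2.congr_deriv (Eq.symm ?_)
      have h2 : ¬ x < -δ := by linarith [hx.1]
      simp only [gg_norm, div_pow, sq_abs]
      simp only [kk, h2, hx.2, if_true, if_false]
      have hs := Real.sin_sq_add_cos_sq (x / 2)
      rw [Real.tan_eq_sin_div_cos]
      have hs' : Real.sin (x / 2) ^ 2 = 1 - Real.cos (x / 2) ^ 2 := by linarith
      field_simp
      push_cast
      field_simp
      rw [hs']
      ring
  rw [e1, e2, e3]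
  simp only [intervalIntegral.integral_const, smul_eq_mul]
  field_simp
  ring

lemma hpp : -π < π := by linarith [Real.pi_pos]

lemma bcoef_eq (δ : ℝ) (n : ℤ) : bcoef δ n = fourierCoeffOn hpp (fdel δ) n := by
  rw [fourierCoeffOn_eq_integral, bcoef, Complex.real_smul]
  congr 1
  · push_cast; ring
  · refine intervalIntegral.integral_congr fun x _ => ?_
    have : (π : ℂ) ≠ 0 := by exact_mod_cast Real.pi_ne_zero
    simp only [fourier_coe_apply, smul_eq_mul]
    rw [mul_comm]
    congr 2
    push_cast
    field_simp
    ring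

lemma bcoef_zero {δ : ℝ} (hδ : 0 < δ) (hδπ : δ < π) : bcoef δ 0 = 1 / 2 := by
  have hc := hh_cont hδ hδπ
  have hp : (π : ℂ) ≠ 0 := by exact_mod_cast Real.pi_ne_zero
  have : ∫ θ in (-π)..π, fdel δ θ = π := by
    simp only [fdel_eq _ _ hδπ]
    rw [intervalIntegral.integral_add (by simp)
      ((by fun_prop : Continuous fun x => Complex.I / 2 * (hh δ x : ℂ)).intervalIntegrable _ _),
      intervalIntegral.integral_const_mul, intervalIntegral.integral_ofReal, hh_int hδ hδπ]
    simp
    ring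
  simp only [bcoef, Int.cast_zero, mul_zero, zero_mul, neg_zero, Complex.exp_zero, mul_one, this]
  field_simp

lemma norm_acoef (δ : ℝ) (n : ℤ) : ‖acoef δ n‖ = ‖bcoef δ n‖ := by
  simp [acoef]

lemma norm_bcoef {δ : ℝ} (hδ : 0 < δ) (hδπ : δ < π) (n : ℤ) :
    ‖bcoef δ n‖ = (if n = 0 then 1 / 2 else 0) + 1 / |(n : ℝ)| * ‖fourierCoeffOn hpp (gg δ) n‖ := by
  split_ifs with hn
  · subst hn; rw [bcoef_zero hδ hδπ]; simp
  · rw [bcoef_eq, fourierCoeffOn_of_hasDeriv_right hpp hn (fdel_cont hδ hδπ).continuousOn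
      (fun x _ => fdel_deriv hδ hδπ x) (gg_ii hδ hδπ _ _), fdel_per hδ hδπ]
    have hp : (π : ℂ) ≠ 0 := by exact_mod_cast Real.pi_ne_zero
    have hn' : (n : ℂ) ≠ 0 := by exact_mod_cast hn
    have : (1 : ℂ) / (-2 * π * Complex.I * n) * (fourier (-n) ((-π : ℝ) : AddCircle (π - -π)) *
        (fdel δ π - fdel δ π) - ((π : ℝ) - ((-π : ℝ) : ℂ)) * fourierCoeffOn hpp (gg δ) n)
        = 1 / (Complex.I * n) * fourierCoeffOn hpp (gg δ) n := by
      push_cast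
      have := Complex.I_ne_zero
      field_simp
      ring
    rw [this]
    simp

lemma zeta_int : HasSum (fun n : ℤ => (1 / |(n : ℝ)|) ^ 2) (π ^ 2 / 3) := by
  have h := hasSum_zeta_two
  have := HasSum.of_nat_of_neg (f := fun n : ℤ => (1 / |(n : ℝ)|) ^ 2) (g := π ^ 2 / 6) (g' := π ^ 2 / 6)
    (by simpa using h) (by simpa using h)
  have e : π ^ 2 / 3 = π ^ 2 / 6 + π ^ 2 / 6 - (1 / |((0 : ℤ) : ℝ)|) ^ 2 := by
    simp; ring
  rw [e]; exact this

lemma main_sum {δ : ℝ} (hδ : 0 < δ) (hδπ : δ < π) :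
    (Summable fun m : ℤ => ‖acoef δ m‖) ∧
    ∑' m : ℤ, ‖acoef δ m‖ ≤ 1 / 2 + √(π ^ 2 / 3) * √((2 * π)⁻¹ * ∫ θ in (-π)..π, ‖gg δ θ‖ ^ 2) := by
  have hz := zeta_int
  have hg := hasSum_sq_fourierCoeffOn hpp (gg_memLp hδ hδπ (Set.Ioc (-π) π) 2)
  have H := Real.summable_and_inner_le_Lp_mul_Lq_tsum_of_nonneg (p := 2) (q := 2)
    (f := fun n : ℤ => 1 / |(n : ℝ)|) (g := fun n : ℤ => ‖fourierCoeffOn hpp (gg δ) n‖)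
    Real.HolderConjugate.two_two (fun i => by positivity) (fun i => by positivity)
    (by exact_mod_cast hz.summable) (by exact_mod_cast hg.summable)
  simp only [Real.rpow_two, hz.tsum_eq, hg.tsum_eq, ← Real.sqrt_eq_rpow] at H
  have hs : HasSum (fun n : ℤ => if n = 0 then (1 / 2 : ℝ) else 0) (1 / 2) := hasSum_ite_eq 0 _
  simp only [norm_acoef, norm_bcoef hδ hδπ]
  refine ⟨hs.summable.add H.1, ?_⟩
  rw [hs.summable.tsum_add H.1, hs.tsum_eq]
  have : π - -π = 2 * π := by ring
  rw [smul_eq_mul, this] at H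
  linarith [H.2]

lemma main_pt {δ : ℝ} (hδ : 0 < δ) (hδπ : δ < π) (θ : ℝ) (hθ : θ ∈ Set.Ioo (-δ) δ) :
      ∑' m : ℤ, (-1 : ℂ) ^ m * acoef δ m * Complex.exp (Complex.I * (m : ℂ) * (θ : ℂ))
        = 1 / (1 + Complex.exp (Complex.I * (θ : ℂ))) := by
  have : Fact (0 < π - -π) := ⟨by linarith [Real.pi_pos]⟩
  have hp : (π : ℂ) ≠ 0 := by exact_mod_cast Real.pi_ne_zero
  have hcont : Continuous (AddCircle.liftIoc (π - -π) (-π) (fdel δ)) :=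
    AddCircle.liftIoc_continuous (by rw [fdel_per hδ hδπ]; congr 1; ring)
      (fdel_cont hδ hδπ).continuousOn
  let F : C(AddCircle (π - -π), ℂ) := ⟨_, hcont⟩
  have hF : ∀ n, fourierCoeff F n = bcoef δ n := fun n => (bcoef_eq δ n).symm
  have hsum : Summable (fourierCoeff F) := by
    refine Summable.of_norm ?_
    simp only [hF]
    simpa only [norm_acoef] using (main_sum hδ hδπ).1
  have h := has_pointwise_sum_fourier_series_of_summable hsum (θ : AddCircle (π - -π))
  have hval : F (θ : AddCircle (π - -π)) = fdel δ θ :=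
    AddCircle.liftIoc_coe_apply (f := fdel δ) (a := -π) ⟨by linarith [hθ.1], by linarith [hθ.2]⟩
  rw [hval] at h
  have hv : fdel δ θ = 1 / (1 + Complex.exp (Complex.I * (θ : ℂ))) := by
    rw [fdel_eq _ _ hδπ, hh2 hδ hδπ hθ.1.le hθ.2.le]
    have hc := cos_half_pos (show -π < θ by linarith [hθ.1]) (show θ < π by linarith [hθ.2])
    have hc' : Complex.cos ((θ : ℂ) / 2) ≠ 0 := by
      have : ((Real.cos (θ / 2) : ℝ) : ℂ) ≠ 0 := by exact_mod_cast hc.ne'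
      simpa using this
    have e1 : 1 + Complex.exp (Complex.I * θ) =
        2 * Complex.cos ((θ : ℂ) / 2) * (Complex.cos ((θ : ℂ) / 2) + Complex.sin ((θ : ℂ) / 2) * Complex.I) := by
      rw [show Complex.I * (θ : ℂ) = (2 * ((θ : ℂ) / 2)) * Complex.I by ring, Complex.exp_mul_I,
        Complex.cos_two_mul, Complex.sin_two_mul]
      ring
    have e2 : (Complex.cos ((θ : ℂ) / 2) - Complex.sin ((θ : ℂ) / 2) * Complex.I) *
        (Complex.cos ((θ : ℂ) / 2) + Complex.sin ((θ : ℂ) / 2) * Complex.I) = 1 := by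
      have := Complex.sin_sq_add_cos_sq ((θ : ℂ) / 2)
      linear_combination this - Complex.sin ((θ : ℂ) / 2) ^ 2 * Complex.I_sq
    have h3 := right_ne_zero_of_mul_eq_one e2
    rw [e1]
    push_cast
    rw [Complex.tan_eq_sin_div_cos, eq_div_iff (mul_ne_zero (mul_ne_zero two_ne_zero hc') h3)]
    field_simp
    linear_combination e2
  rw [← hv, ← h.tsum_eq]
  refine tsum_congr fun n => ?_
  have hneg : (-1 : ℂ) ^ n * (-1 : ℂ) ^ n = 1 := by
    rw [← mul_zpow]; simp
  rw [hF, acoef, ← mul_assoc, hneg, one_mul, smul_eq_mul, fourier_coe_apply]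
  congr 2
  push_cast
  field_simp
  ring

/-- (i) `f` is absolutely continuous (it is the integral of an integrable
function `g`, its a.e. derivative), `f(−π) = f(π)`, and
`∫_{−π}^{π} |f′|² = tan²(δ/2)/(2(π−δ)) + tan³(δ/2)/12 + tan(δ/2)/4`;
(ii) the sequence `a_n = (−1)ⁿ b_n` built from the Fourier coefficients of `f` is absolutely
summable, `Σ (−1)ⁿ a_n e^{inθ} = 1/(1 + e^{iθ})` on `(−δ, δ)`, and
`2 Σ |a_n| ≤ 1 + (π/√3) √(2 tan²(δ/2)/(π−δ) + tan³(δ/2)/3 + tan(δ/2))`. -/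
theorem stmt19 (δ : ℝ) (hδ₀ : 0 < δ) (hδπ : δ < π) :
    (∃ g : ℝ → ℂ,
      IntervalIntegrable g volume (-π) π ∧
      (∀ θ ∈ Set.Icc (-π) π, fdel δ θ = fdel δ (-π) + ∫ s in (-π)..θ, g s) ∧
      fdel δ (-π) = fdel δ π ∧
      (∫ θ in (-π)..π, ‖g θ‖ ^ 2)
        = Real.tan (δ / 2) ^ 2 / (2 * (π - δ)) + Real.tan (δ / 2) ^ 3 / 12
          + Real.tan (δ / 2) / 4) ∧
    (Summable fun m : ℤ => ‖acoef δ m‖) ∧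
    (∀ θ ∈ Set.Ioo (-δ) δ,
      ∑' m : ℤ, (-1 : ℂ) ^ m * acoef δ m * Complex.exp (Complex.I * (m : ℂ) * (θ : ℂ))
        = 1 / (1 + Complex.exp (Complex.I * (θ : ℂ)))) ∧
    2 * ∑' m : ℤ, ‖acoef δ m‖ ≤
      1 + π / Real.sqrt 3 *
        Real.sqrt (2 * Real.tan (δ / 2) ^ 2 / (π - δ) + Real.tan (δ / 2) ^ 3 / 3
          + Real.tan (δ / 2)) := by
  refine ⟨⟨gg δ, gg_ii hδ₀ hδπ _ _, fun θ hθ => ?_, fdel_per hδ₀ hδπ, gg_int hδ₀ hδπ⟩,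
    (main_sum hδ₀ hδπ).1, fun θ hθ => main_pt hδ₀ hδπ θ hθ, ?_⟩
  · rw [intervalIntegral.integral_eq_sub_of_hasDeriv_right_of_le hθ.1
      (fdel_cont hδ₀ hδπ).continuousOn (fun x _ => fdel_deriv hδ₀ hδπ x) (gg_ii hδ₀ hδπ _ _)]
    ring
  · have h := (main_sum hδ₀ hδπ).2
    have hJ : 0 ≤ ∫ θ in (-π)..π, ‖gg δ θ‖ ^ 2 :=
      intervalIntegral.integral_nonneg hpp.le fun x _ => by positivity
    have h0 : π - δ ≠ 0 := (sub_pos.2 hδπ).ne'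
    have e : 2 * Real.tan (δ / 2) ^ 2 / (π - δ) + Real.tan (δ / 2) ^ 3 / 3
          + Real.tan (δ / 2) = 2 ^ 2 * ∫ θ in (-π)..π, ‖gg δ θ‖ ^ 2 := by
      rw [gg_int hδ₀ hδπ]; field_simp; ring
    rw [e, Real.sqrt_mul (by positivity), Real.sqrt_sq (by norm_num)]
    rw [Real.sqrt_div (by positivity), Real.sqrt_sq Real.pi_pos.le] at h
    have h1 : √((2 * π)⁻¹ * ∫ θ in (-π)..π, ‖gg δ θ‖ ^ 2) ≤ √(∫ θ in (-π)..π, ‖gg δ θ‖ ^ 2) := by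
      apply Real.sqrt_le_sqrt
      refine mul_le_of_le_one_left hJ (inv_le_one_of_one_le₀ ?_)
      linarith [Real.pi_gt_three]
    have h2 := mul_le_mul_of_nonneg_left h1 (show 0 ≤ π / √3 by positivity)
    linarith
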